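/- arXiv:1911.05858 — 2 statements merged into one kernel-verified Lean document; each statement's English description precedes it below -/
import Mathlib

section
/- Let A be a block matrix (indexed by Σ v : Fin n, Fin (N v)) admitting a G-SS representation A = 𝐃 + Z_d[𝐔](I − Z_d[𝐖])⁻¹𝐕ᵀ + Z_u[𝐏](I − Z_u[𝐑])⁻¹𝐐ᵀ with state dimensions r^g, r^h : Fin n → ℕ, and set r = max over v of max(r^g_v, r^h_v). Then (A,G) is GIRS-4r: for every subset S ⊆ Fin n, rank(A_{S̄,S}) ≤ 4·r·ρ(S). -/
open Matrix

variable {𝔽 : Type*} [Field 𝔽] {n : ℕ}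

/-- The downstream block operator `Z_d[·]` for a graph `G` on `Fin n` with its natural order:
the block matrix whose `(v,w)` block is `W v w` if `{v,w}` is an edge of `G` with `v < w`,
and `0` otherwise (strictly block upper triangular). -/
def Zd (G : SimpleGraph (Fin n)) [DecidableRel G.Adj] {a b : Fin n → ℕ}
    (W : ∀ v w : Fin n, Matrix (Fin (a v)) (Fin (b w)) 𝔽) :
    Matrix ((v : Fin n) × Fin (a v)) ((v : Fin n) × Fin (b v)) 𝔽 :=
  Matrix.of fun p q => if G.Adj p.1 q.1 ∧ p.1 < q.1 then W p.1 q.1 p.2 q.2 else 0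

/-- The upstream block operator `Z_u[·]`: the block matrix whose `(v,w)` block is `R v w` if
`{v,w}` is an edge of `G` with `w < v`, and `0` otherwise (strictly block lower
triangular). -/
def Zu (G : SimpleGraph (Fin n)) [DecidableRel G.Adj] {a b : Fin n → ℕ}
    (R : ∀ v w : Fin n, Matrix (Fin (a v)) (Fin (b w)) 𝔽) :
    Matrix ((v : Fin n) × Fin (a v)) ((v : Fin n) × Fin (b v)) 𝔽 :=
  Matrix.of fun p q => if G.Adj p.1 q.1 ∧ q.1 < p.1 then R p.1 q.1 p.2 q.2 else 0

/-- The Hankel block `A_{S̄,S}` of a graph-partitioned matrix: rows whose block index lies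
outside `S`, columns whose block index lies in `S`. -/
def hankelBlock {N : Fin n → ℕ}
    (A : Matrix ((v : Fin n) × Fin (N v)) ((v : Fin n) × Fin (N v)) 𝔽) (S : Finset (Fin n)) :
    Matrix {p : (v : Fin n) × Fin (N v) // p.1 ∉ S} {p : (v : Fin n) × Fin (N v) // p.1 ∈ S} 𝔽 :=
  Matrix.of fun i j => A i.1 j.1

/-- `ρ(S)`: the number of edges of `G` with exactly one endpoint in `S` (each such edge is
counted once, as the ordered pair with first endpoint outside `S`). -/
def borderEdges (G : SimpleGraph (Fin n)) [DecidableRel G.Adj] (S : Finset (Fin n)) : ℕ :=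
  (Finset.univ.filter fun p : Fin n × Fin n => G.Adj p.1 p.2 ∧ p.1 ∉ S ∧ p.2 ∈ S).card

/-- A matrix whose kernel contains the kernel of `B` has rank at most the number of rows of `B`. -/
theorem rank_le_card_of_mulVec_eq_zero {K l m k : Type*} [Field K] [Fintype l] [Fintype m]
    [Fintype k] (A : Matrix l m K) (B : Matrix k m K) (h : ∀ x, B *ᵥ x = 0 → A *ᵥ x = 0) :
    A.rank ≤ Fintype.card k := by
  have hker : LinearMap.ker B.mulVecLin ≤ LinearMap.ker A.mulVecLin := fun x hx => h x hx
  have hA := A.mulVecLin.finrank_range_add_finrank_ker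
  have hB := B.mulVecLin.finrank_range_add_finrank_ker
  have hle := Submodule.finrank_mono hker
  have hBk : B.rank ≤ Fintype.card k := B.rank_le_card_height
  simp only [Matrix.rank] at hBk ⊢
  omega

/-- The rank of matrices is subadditive. -/
theorem rank_add_le_rank_add_rank {K l m : Type*} [Field K] [Fintype l] [Fintype m]
    (A B : Matrix l m K) : (A + B).rank ≤ A.rank + B.rank := by
  have h : LinearMap.range (A + B).mulVecLin ≤
      LinearMap.range A.mulVecLin ⊔ LinearMap.range B.mulVecLin := by
    rw [Matrix.mulVecLin_add]
    exact LinearMap.range_add_le _ _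
  exact (Submodule.finrank_mono h).trans (Submodule.finrank_add_le_finrank_add_finrank _ _)

/-- A block vector satisfying `y = Z y` outside `S`, for a `Z` whose blocks strictly descend along
a well-founded relation, vanishes outside `S` if the entries that `Z` reads from `S` vanish. -/
theorem eq_zero_of_eq_mulVec {K ι : Type*} [Field K] {κ : ι → Type*}
    [Fintype ι] [∀ v, Fintype (κ v)] {lt : ι → ι → Prop} (hlt : WellFounded lt)
    (Z : Matrix ((v : ι) × κ v) ((v : ι) × κ v) K)
    (hZ : ∀ p q, Z p q ≠ 0 → lt q.1 p.1) (S : Finset ι) (y : ((v : ι) × κ v) → K)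
    (hy : ∀ p, p.1 ∉ S → y p = (Z *ᵥ y) p)
    (hS : ∀ p q, p.1 ∉ S → q.1 ∈ S → Z p q ≠ 0 → y q = 0) :
    ∀ p, p.1 ∉ S → y p = 0 := by
  suffices ∀ v, v ∉ S → ∀ i : κ v, y ⟨v, i⟩ = 0 from fun p hp => this p.1 hp p.2
  intro v
  induction v using hlt.induction with
  | _ v ih =>
    intro hv i
    rw [hy ⟨v, i⟩ hv]
    refine Finset.sum_eq_zero fun q _ => ?_
    by_cases h0 : Z ⟨v, i⟩ q = 0
    · simp [h0]
    · by_cases hq : q.1 ∈ S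
      · simp [hS ⟨v, i⟩ q hv hq h0]
      · have : y q = 0 := ih q.1 (hZ _ _ h0) hq q.2
        simp [this]

/-- `1 - Z` is invertible if the blocks of `Z` strictly descend along a well-founded relation. -/
theorem isUnit_one_sub_of_wellFounded {K ι : Type*} [Field K] {κ : ι → Type*}
    [Fintype ι] [DecidableEq ι] [∀ v, Fintype (κ v)] [∀ v, DecidableEq (κ v)]
    {lt : ι → ι → Prop} (hlt : WellFounded lt)
    (Z : Matrix ((v : ι) × κ v) ((v : ι) × κ v) K)
    (hZ : ∀ p q, Z p q ≠ 0 → lt q.1 p.1) : IsUnit (1 - Z) := by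
  rw [← Matrix.mulVec_injective_iff_isUnit, ← Matrix.coe_mulVecLin,
    injective_iff_map_eq_zero]
  intro y hy
  have hy' : y = Z *ᵥ y := by
    rw [Matrix.mulVecLin_apply, Matrix.sub_mulVec, Matrix.one_mulVec] at hy
    exact sub_eq_zero.mp hy
  funext p
  exact eq_zero_of_eq_mulVec hlt Z hZ ∅ y (fun p _ => congrFun hy' p) (by simp) p (by simp)

/-- The state coordinates at the vertices of `S` with a neighbour outside `S` number at most
`r * ρ(S)`. -/
theorem card_border_states_le (G : SimpleGraph (Fin n)) [DecidableRel G.Adj] (a : Fin n → ℕ)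
    (S : Finset (Fin n)) (r : ℕ) (hr : ∀ v, a v ≤ r) :
    Fintype.card ((w : {w : Fin n // w ∈ S ∧ ∃ v, v ∉ S ∧ G.Adj v w}) × Fin (a w)) ≤
      r * borderEdges G S := by
  classical
  rw [Fintype.card_sigma]
  simp only [Fintype.card_fin]
  calc ∑ w : {w : Fin n // w ∈ S ∧ ∃ v, v ∉ S ∧ G.Adj v w}, a w
      ≤ ∑ _w : {w : Fin n // w ∈ S ∧ ∃ v, v ∉ S ∧ G.Adj v w}, r :=
        Finset.sum_le_sum fun w _ => hr w
    _ = r * (Finset.univ.filter fun w => w ∈ S ∧ ∃ v, v ∉ S ∧ G.Adj v w).card := by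
        simp [Fintype.card_subtype, mul_comm]
    _ ≤ r * borderEdges G S := by
        refine Nat.mul_le_mul_left _ ?_
        refine (Finset.card_le_card ?_).trans
          (Finset.card_image_le (f := Prod.snd) (s := Finset.univ.filter
            fun p : Fin n × Fin n => G.Adj p.1 p.2 ∧ p.1 ∉ S ∧ p.2 ∈ S))
        intro w hw
        simp only [Finset.mem_filter, Finset.mem_univ, true_and] at hw
        obtain ⟨hwS, v, hv, hadj⟩ := hw
        exact Finset.mem_image.mpr ⟨(v, w), by simp [hadj, hv, hwS], rfl⟩

/-- Each one-sided term of a `G`-SS representation has Hankel blocks of rank at most `r * ρ(S)`. -/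
theorem rank_hankelBlock_le (G : SimpleGraph (Fin n)) [DecidableRel G.Adj] (N a : Fin n → ℕ)
    {lt : Fin n → Fin n → Prop} (hlt : WellFounded lt)
    (Z : Matrix ((v : Fin n) × Fin (a v)) ((v : Fin n) × Fin (a v)) 𝔽)
    (Y : Matrix ((v : Fin n) × Fin (N v)) ((v : Fin n) × Fin (a v)) 𝔽)
    (F : ∀ v, Matrix (Fin (N v)) (Fin (a v)) 𝔽)
    (hZ : ∀ p q, Z p q ≠ 0 → G.Adj p.1 q.1 ∧ lt q.1 p.1)
    (hY : ∀ p q, Y p q ≠ 0 → G.Adj p.1 q.1)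
    (S : Finset (Fin n)) (r : ℕ) (hr : ∀ v, a v ≤ r) :
    (hankelBlock (Y * (1 - Z)⁻¹ * (Matrix.blockDiagonal' F)ᵀ) S).rank ≤
      r * borderEdges G S := by
  set X := (1 - Z)⁻¹ * (Matrix.blockDiagonal' F)ᵀ with hX
  have hXeq : X = Z * X + (Matrix.blockDiagonal' F)ᵀ := by
    have hunit := isUnit_one_sub_of_wellFounded hlt Z fun p q h => (hZ p q h).2
    have h : (1 - Z) * X = (Matrix.blockDiagonal' F)ᵀ := by
      rw [hX, Matrix.mul_nonsing_inv_cancel_left _ _ ((Matrix.isUnit_iff_isUnit_det _).mp hunit)]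
    rw [← h, Matrix.sub_mul, Matrix.one_mul, add_sub_cancel]
  rw [Matrix.mul_assoc, ← hX]
  let B : Matrix ((w : {w : Fin n // w ∈ S ∧ ∃ v, v ∉ S ∧ G.Adj v w}) × Fin (a w))
      {p : (v : Fin n) × Fin (N v) // p.1 ∈ S} 𝔽 :=
    X.submatrix (fun q => ⟨q.1.1, q.2⟩) Subtype.val
  classical
  refine (rank_le_card_of_mulVec_eq_zero _ B fun x hx => ?_).trans
    (card_border_states_le G a S r hr)
  let x' : ((v : Fin n) × Fin (N v)) → 𝔽 := fun p => if h : p.1 ∈ S then x ⟨p, h⟩ else 0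
  have hx' : ∀ f : ((v : Fin n) × Fin (N v)) → 𝔽, f ⬝ᵥ x' = (fun j => f (Subtype.val j)) ⬝ᵥ x := by
    intro f
    simp only [dotProduct]
    rw [← Fintype.sum_subtype_add_sum_subtype (fun p : (v : Fin n) × Fin (N v) => p.1 ∈ S),
      Finset.sum_eq_zero (s := Finset.univ (α := {p : (v : Fin n) × Fin (N v) // p.1 ∉ S}))
        fun j _ => by simp [x', j.2], add_zero]
    exact Finset.sum_congr rfl fun j _ => by simp [x', j.2]
  have hborder : ∀ v (q : (v : Fin n) × Fin (a v)), v ∉ S → q.1 ∈ S → G.Adj v q.1 →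
      (X *ᵥ x') q = 0 := by
    intro v q hv hq hadj
    rw [Matrix.mulVec, hx']
    exact congrFun hx ⟨⟨q.1, hq, v, hv, hadj⟩, q.2⟩
  have hout : ∀ p : (v : Fin n) × Fin (a v), p.1 ∉ S → (X *ᵥ x') p = 0 := by
    refine eq_zero_of_eq_mulVec hlt Z (fun p q h => (hZ p q h).2) S _ (fun p hp => ?_)
      fun p q hp hq h => hborder p.1 q hp hq (hZ p q h).1
    conv_lhs => rw [hXeq]
    rw [Matrix.add_mulVec, Matrix.mulVec_mulVec, Pi.add_apply, add_eq_left]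
    refine Finset.sum_eq_zero fun q _ => ?_
    by_cases hq : q.1 ∈ S
    · have hne : q.1 ≠ p.1 := fun h => hp (h ▸ hq)
      simp [Matrix.blockDiagonal'_apply, hne]
    · simp [x', hq]
  funext i
  have hrow : (hankelBlock (Y * X) S *ᵥ x) i = (Y *ᵥ (X *ᵥ x')) i := by
    rw [Matrix.mulVec_mulVec]
    exact (hx' ((Y * X) i.1)).symm
  rw [hrow]
  refine Finset.sum_eq_zero fun q _ => ?_
  by_cases h0 : Y i q = 0
  · simp [h0]
  · by_cases hq : q.1 ∈ S
    · simp [hborder i.1.1 q i.2 hq (hY _ _ h0)]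
    · simp [hout q hq]

/-- If `A` admits a `G`-SS representation
`A = 𝐃 + Z_d[𝐔] (I - Z_d[𝐖])⁻¹ 𝐕ᵀ + Z_u[𝐏] (I - Z_u[𝐑])⁻¹ 𝐐ᵀ` with state dimensions
`rg, rh`, and `r = max_v max (rg v) (rh v)`, then `(A, G)` is GIRS-`4r`:
`rank(A_{S̄,S}) ≤ 4 r ρ(S)` for every subset `S ⊆ Fin n`. -/
theorem gss_isGIRS (G : SimpleGraph (Fin n)) [DecidableRel G.Adj]
    (N rg rh : Fin n → ℕ)
    (D : ∀ v, Matrix (Fin (N v)) (Fin (N v)) 𝔽)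
    (Vf : ∀ v, Matrix (Fin (N v)) (Fin (rg v)) 𝔽)
    (Q : ∀ v, Matrix (Fin (N v)) (Fin (rh v)) 𝔽)
    (W : ∀ v w : Fin n, Matrix (Fin (rg v)) (Fin (rg w)) 𝔽)
    (U : ∀ v w : Fin n, Matrix (Fin (N v)) (Fin (rg w)) 𝔽)
    (R : ∀ v w : Fin n, Matrix (Fin (rh v)) (Fin (rh w)) 𝔽)
    (P : ∀ v w : Fin n, Matrix (Fin (N v)) (Fin (rh w)) 𝔽)
    (A : Matrix ((v : Fin n) × Fin (N v)) ((v : Fin n) × Fin (N v)) 𝔽)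
    (hA : A = Matrix.blockDiagonal' D +
      Zd G U * (1 - Zd G W)⁻¹ * (Matrix.blockDiagonal' Vf)ᵀ +
      Zu G P * (1 - Zu G R)⁻¹ * (Matrix.blockDiagonal' Q)ᵀ)
    (S : Finset (Fin n)) :
    (hankelBlock A S).rank ≤
      4 * (Finset.univ.sup fun v => max (rg v) (rh v)) * borderEdges G S := by
  set r := Finset.univ.sup fun v => max (rg v) (rh v)
  have hmax : ∀ v, max (rg v) (rh v) ≤ r := fun v =>
    Finset.le_sup (f := fun v => max (rg v) (rh v)) (Finset.mem_univ v)
  have hd := rank_hankelBlock_le G N rg (lt := (· > ·)) wellFounded_gt (Zd G W) (Zd G U) Vf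
    (fun p q h => (ite_ne_right_iff.mp h).1)
    (fun p q h => (ite_ne_right_iff.mp h).1.1) S r
    fun v => (le_max_left _ _).trans (hmax v)
  have hu := rank_hankelBlock_le G N rh (lt := (· < ·)) wellFounded_lt (Zu G R) (Zu G P) Q
    (fun p q h => (ite_ne_right_iff.mp h).1)
    (fun p q h => (ite_ne_right_iff.mp h).1.1) S r
    fun v => (le_max_right _ _).trans (hmax v)
  have hsplit : hankelBlock A S =
      hankelBlock (Zd G U * (1 - Zd G W)⁻¹ * (Matrix.blockDiagonal' Vf)ᵀ) S +
      hankelBlock (Zu G P * (1 - Zu G R)⁻¹ * (Matrix.blockDiagonal' Q)ᵀ) S := by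
    ext i j
    have hne : i.1.1 ≠ j.1.1 := fun h => i.2 (h ▸ j.2)
    simp [hA, hankelBlock, Matrix.blockDiagonal'_apply, hne]
  rw [hsplit]
  refine (rank_add_le_rank_add_rank _ _).trans ?_
  linarith [Nat.zero_le (r * borderEdges G S)]
end

section
/- Let G be a finite simple graph on V = Fin n that contains the Hamiltonian path along the natural order (i.e., {v, v+1} is an edge of G for every 0 ≤ v ≤ n−2), and let A be any block matrix over 𝔽 indexed by Σ v : Fin n, Fin (N v). Then A admits a G-SS representation: there exist state dimensions r^g, r^h : Fin n → ℕ and matrices D_v, V_v, Q_v, W_{v,w}, U_{v,w}, R_{v,w}, P_{v,w} (supported on the edges of G as in the definition) such that A = 𝐃 + Z_d[𝐔](I − Z_d[𝐖])⁻¹𝐕ᵀ + Z_u[𝐏](I − Z_u[𝐑])⁻¹𝐐ᵀ. -/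
open Matrix

variable {𝔽 : Type*} [Field 𝔽] {n : ℕ}

/-- The block matrix whose `(v,w)` block is `X v w` if `{v,w}` is an edge of `G` with `r v w`,
and `0` otherwise. -/
def edgeBlock (G : SimpleGraph (Fin n)) [DecidableRel G.Adj] (r : Fin n → Fin n → Prop)
    [DecidableRel r] {a b : Fin n → ℕ}
    (X : ∀ v w : Fin n, Matrix (Fin (a v)) (Fin (b w)) 𝔽) :
    Matrix ((v : Fin n) × Fin (a v)) ((v : Fin n) × Fin (b v)) 𝔽 :=
  Matrix.of fun p q => if G.Adj p.1 q.1 ∧ r p.1 q.1 then X p.1 q.1 p.2 q.2 else 0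

/-- The block matrix with identity blocks at all `(v,w)` with `v = w` or `r v w`. -/
def reachBlock (r : Fin n → Fin n → Prop) [DecidableRel r] (M : ℕ) :
    Matrix ((_ : Fin n) × Fin M) ((_ : Fin n) × Fin M) 𝔽 :=
  Matrix.of fun p q => if (p.1 = q.1 ∨ r p.1 q.1) ∧ p.2 = q.2 then 1 else 0

/-- A block matrix supported on the successor edges, times `reachBlock`, repeats its
blocks over all larger vertices. -/
theorem edgeBlock_mul_reachBlock (G : SimpleGraph (Fin n)) [DecidableRel G.Adj]
    (r : Fin n → Fin n → Prop) [DecidableRel r] [IsStrictOrder (Fin n) r]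
    (nxt : Fin n → Fin n)
    (hnxt : ∀ v w, r v w → G.Adj v (nxt v) ∧ r v (nxt v) ∧ (nxt v = w ∨ r (nxt v) w))
    {a : Fin n → ℕ} {M : ℕ} (B : ∀ v, Matrix (Fin (a v)) (Fin M) 𝔽)
    (p : (v : Fin n) × Fin (a v)) (q : (_ : Fin n) × Fin M) :
    (edgeBlock (𝔽 := 𝔽) G r (b := fun _ => M) (fun v w => if w = nxt v then B v else 0) *
      reachBlock (𝔽 := 𝔽) r M) p q = if r p.1 q.1 then B p.1 p.2 q.2 else 0 := by
  obtain ⟨v, i⟩ := p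
  obtain ⟨w, j⟩ := q
  rw [Matrix.mul_apply, Finset.sum_eq_single ⟨nxt v, j⟩]
  · by_cases h : r v w
    · obtain ⟨h₁, h₂, h₃⟩ := hnxt v w h
      simp [edgeBlock, reachBlock, h, h₁, h₂, h₃]
    · have h' : ¬ (r v (nxt v) ∧ (nxt v = w ∨ r (nxt v) w)) := by
        rintro ⟨h₂, rfl | h₃⟩
        · exact h h₂
        · exact h (_root_.trans h₂ h₃)
      simp only [edgeBlock, reachBlock, Matrix.of_apply, h, if_false]
      split_ifs <;> simp_all
  · rintro ⟨u, k⟩ - hne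
    by_cases hu : u = nxt v
    · subst hu
      have hk : k ≠ j := fun hk => hne (by rw [hk])
      simp [reachBlock, hk]
    · simp [edgeBlock, hu]
  · simp

theorem inv_one_sub_edgeBlock (G : SimpleGraph (Fin n)) [DecidableRel G.Adj]
    (r : Fin n → Fin n → Prop) [DecidableRel r] [IsStrictOrder (Fin n) r]
    (nxt : Fin n → Fin n)
    (hnxt : ∀ v w, r v w → G.Adj v (nxt v) ∧ r v (nxt v) ∧ (nxt v = w ∨ r (nxt v) w))
    (M : ℕ) :
    (1 - edgeBlock G r (a := fun _ => M) (b := fun _ => M)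
      (fun v w => if w = nxt v then (1 : Matrix (Fin M) (Fin M) 𝔽) else 0))⁻¹ =
      reachBlock r M := by
  apply Matrix.inv_eq_right_inv
  rw [Matrix.sub_mul, Matrix.one_mul]
  ext ⟨v, i⟩ ⟨w, j⟩
  rw [Matrix.sub_apply, edgeBlock_mul_reachBlock G r nxt hnxt (fun _ => 1)]
  by_cases hvw : v = w
  · subst hvw
    simp [reachBlock, Matrix.one_apply, irrefl_of r v]
  · by_cases h : r v w <;> simp [reachBlock, Matrix.one_apply, hvw, h]

/-- The part of `A` whose block positions satisfy `r` is realised by state matrices supported on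
the edges of `G` compatible with `r`, as soon as `G` contains all successor edges of `r`. -/
theorem exists_edgeBlock_rep (G : SimpleGraph (Fin n)) [DecidableRel G.Adj]
    (r : Fin n → Fin n → Prop) [DecidableRel r] [IsStrictOrder (Fin n) r]
    (nxt : Fin n → Fin n)
    (hnxt : ∀ v w, r v w → G.Adj v (nxt v) ∧ r v (nxt v) ∧ (nxt v = w ∨ r (nxt v) w))
    (N : Fin n → ℕ)
    (A : Matrix ((v : Fin n) × Fin (N v)) ((v : Fin n) × Fin (N v)) 𝔽) :
    ∃ (s : Fin n → ℕ)
      (Vf : ∀ v, Matrix (Fin (N v)) (Fin (s v)) 𝔽)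
      (W : ∀ v w : Fin n, Matrix (Fin (s v)) (Fin (s w)) 𝔽)
      (U : ∀ v w : Fin n, Matrix (Fin (N v)) (Fin (s w)) 𝔽),
      ∀ p q, (edgeBlock G r U * (1 - edgeBlock G r W)⁻¹ * (Matrix.blockDiagonal' Vf)ᵀ) p q =
        if r p.1 q.1 then A p q else 0 := by
  let e := Fintype.equivFin ((v : Fin n) × Fin (N v))
  refine ⟨fun _ => _, fun v => Matrix.of fun j m => if m = e ⟨v, j⟩ then 1 else 0,
    fun v w => if w = nxt v then 1 else 0,
    fun v w => if w = nxt v then Matrix.of fun i m => A ⟨v, i⟩ (e.symm m) else 0, ?_⟩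
  rintro p ⟨w, j⟩
  rw [inv_one_sub_edgeBlock G r nxt hnxt, Matrix.mul_apply,
    Finset.sum_eq_single ⟨w, e ⟨w, j⟩⟩]
  · rw [edgeBlock_mul_reachBlock G r nxt hnxt
      (fun v => Matrix.of fun i m => A ⟨v, i⟩ (e.symm m))]
    simp [Matrix.blockDiagonal'_apply]
  · rintro ⟨u, m⟩ - hne
    by_cases hu : w = u
    · subst hu
      have hm : m ≠ e ⟨w, j⟩ := fun hm => hne (by rw [hm])
      simp [Matrix.blockDiagonal'_apply, hm]
    · simp [Matrix.blockDiagonal'_apply, hu]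
  · simp

/-- If `G` is a graph on `Fin n` containing the Hamiltonian path along the
natural order (i.e. `{v, v+1}` is an edge of `G` for every `0 ≤ v ≤ n - 2`), then every block
matrix `A` indexed by `Σ v : Fin n, Fin (N v)` admits a `G`-SS representation
`A = 𝐃 + Z_d[𝐔] (I - Z_d[𝐖])⁻¹ 𝐕ᵀ + Z_u[𝐏] (I - Z_u[𝐑])⁻¹ 𝐐ᵀ`. -/
theorem exists_gss_rep (G : SimpleGraph (Fin n)) [DecidableRel G.Adj]
    (hHam : ∀ i : ℕ, (h : i + 1 < n) → G.Adj ⟨i, Nat.lt_of_succ_lt h⟩ ⟨i + 1, h⟩)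
    (N : Fin n → ℕ)
    (A : Matrix ((v : Fin n) × Fin (N v)) ((v : Fin n) × Fin (N v)) 𝔽) :
    ∃ (rg rh : Fin n → ℕ)
      (D : ∀ v, Matrix (Fin (N v)) (Fin (N v)) 𝔽)
      (Vf : ∀ v, Matrix (Fin (N v)) (Fin (rg v)) 𝔽)
      (Q : ∀ v, Matrix (Fin (N v)) (Fin (rh v)) 𝔽)
      (W : ∀ v w : Fin n, Matrix (Fin (rg v)) (Fin (rg w)) 𝔽)
      (U : ∀ v w : Fin n, Matrix (Fin (N v)) (Fin (rg w)) 𝔽)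
      (R : ∀ v w : Fin n, Matrix (Fin (rh v)) (Fin (rh w)) 𝔽)
      (P : ∀ v w : Fin n, Matrix (Fin (N v)) (Fin (rh w)) 𝔽),
      A = Matrix.blockDiagonal' D +
        Zd G U * (1 - Zd G W)⁻¹ * (Matrix.blockDiagonal' Vf)ᵀ +
        Zu G P * (1 - Zu G R)⁻¹ * (Matrix.blockDiagonal' Q)ᵀ := by
  obtain ⟨rg, Vf, W, U, hd⟩ := exists_edgeBlock_rep G (· < ·)
    (fun v => if h : v.1 + 1 < n then ⟨v.1 + 1, h⟩ else v) (by
      intro v w hvw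
      have h : v.1 + 1 < n := by omega
      simp only [h, dif_pos, Fin.lt_def, Fin.ext_iff]
      exact ⟨hHam v.1 h, by omega, by omega⟩) N A
  obtain ⟨rh, Q, R, P, hu⟩ := exists_edgeBlock_rep G (· > ·)
    (fun v => ⟨v.1 - 1, by omega⟩) (by
      rintro ⟨_ | k, hk⟩ w hvw
      · exact absurd hvw (by simp [Fin.lt_def])
      · have hw : w.1 < k + 1 := hvw
        refine ⟨(hHam k hk).symm, ?_, ?_⟩ <;>
          simp only [gt_iff_lt, Fin.lt_def, Fin.ext_iff] <;> omega) N A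
  refine ⟨rg, rh, fun v => Matrix.of fun i j => A ⟨v, i⟩ ⟨v, j⟩, Vf, Q, W, U, R, P, ?_⟩
  ext ⟨v, i⟩ ⟨w, j⟩
  have hd' := hd ⟨v, i⟩ ⟨w, j⟩
  have hu' := hu ⟨v, i⟩ ⟨w, j⟩
  change (Zd G U * (1 - Zd G W)⁻¹ * (Matrix.blockDiagonal' Vf)ᵀ) _ _ = _ at hd'
  change (Zu G P * (1 - Zu G R)⁻¹ * (Matrix.blockDiagonal' Q)ᵀ) _ _ = _ at hu'
  rw [Matrix.add_apply, Matrix.add_apply, hd', hu']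
  rcases lt_trichotomy v w with h | rfl | h
  · simp [Matrix.blockDiagonal'_apply, h, h.ne, h.not_gt]
  · simp [Matrix.blockDiagonal'_apply]
  · simp [Matrix.blockDiagonal'_apply, h, h.ne', h.not_gt]
end
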